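/- Let I ⊆ R be an S_n-invariant monomial ideal and let μ = (d_1^{p_1},…,d_s^{p_s},0^{p_{s+1}}) ∈ P_n with d_1 > ⋯ > d_s > 0. Then for every i ≥ 0, dim_k Tor_i(I,k)_{⟨μ⟩} = Σ_{0 ≤ c ≤ p(μ)} D(c) · γ_{i−|c|}^{μ,c}(I), where the sum ranges over c = (c_1,…,c_s) ∈ Z_{≥0}^s with c ≤ p(μ), |c| = c_1+⋯+c_s, γ_j := 0 for j < 0, and D(c) = (n! / (p_1!⋯p_s!·p_{s+1}!)) · Π_{k=1}^s C(p_k−1, c_k) (which is the dimension of the induced S_n-representation Ind_{S_{p_1}×⋯×S_{p_s}×S_{p_{s+1}}}^{S_n}(S^{(p_1−c_1,1^{c_1})} ⊠ ⋯ ⊠ S^{(p_s−c_s,1^{c_s})} ⊠ S^{(p_{s+1})}) of tensor products of hook Specht modules, since dim_k S^{(p−c,1^c)} = C(p−1,c)). -/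

import Mathlib

open scoped BigOperators

noncomputable section
open Classical

/-! ## Generic (labeled) simplicial chain complexes and reduced homology over a field -/

section Homology

variable (K : Type) [Field K] {α : Type}

/-- Index type for chains: elements of `S` whose face (second component) has `j` elements. -/
def ChainIdx (S : Set (α × Finset ℕ)) (j : ℕ) : Type :=
  {q : α × Finset ℕ // q ∈ S ∧ q.2.card = j}

/-- The boundary of a basis element, with the usual simplicial signs. -/
noncomputable def bdElt (S : Set (α × Finset ℕ)) (j : ℕ) (q : ChainIdx S (j + 1)) :
    ChainIdx S j →₀ K :=
  ∑ v ∈ q.1.2,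
    if h : (q.1.1, q.1.2.erase v) ∈ S ∧ (q.1.2.erase v).card = j then
      ((-1 : K) ^ (q.1.2.filter (fun u => u ≤ v)).card) •
        Finsupp.single (⟨(q.1.1, q.1.2.erase v), h⟩ : ChainIdx S j) (1 : K)
    else 0

/-- The simplicial boundary map. -/
noncomputable def bd (S : Set (α × Finset ℕ)) (j : ℕ) :
    (ChainIdx S (j + 1) →₀ K) →ₗ[K] (ChainIdx S j →₀ K) :=
  Finsupp.linearCombination K (bdElt K S j)

/-- Cycles in homological degree `j` (chains are indexed by the cardinality of faces;
degree `j` corresponds to reduced topological degree `j - 1`). -/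
noncomputable def cycles (S : Set (α × Finset ℕ)) : (j : ℕ) → Submodule K (ChainIdx S j →₀ K)
  | 0 => ⊤
  | (i + 1) => LinearMap.ker (bd K S i)

/-- `rhd K S j` is the dimension of the reduced homology group `H̃_{j-1}` of the complex `S`
(the chain groups being finite dimensional, this is `dim` cycles `- dim` boundaries). -/
noncomputable def rhd (S : Set (α × Finset ℕ)) (j : ℕ) : ℕ :=
  Module.finrank K (cycles K S j) -
    Module.finrank K (LinearMap.range (bd K S j) ⊓ cycles K S j : Submodule K _)

/-- `hdim K S j = dim_K H̃_j(S; K)`, for `j : ℤ` (zero for `j ≤ -2`). -/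
noncomputable def hdim (S : Set (α × Finset ℕ)) (j : ℤ) : ℕ :=
  if 0 ≤ j + 1 then rhd K S (j + 1).toNat else 0

/-- View an unlabeled collection of faces as a labeled one (labels in `Unit`). -/
def lab (Δ : Set (Finset ℕ)) : Set (Unit × Finset ℕ) := {q | q.2 ∈ Δ}

/-- Dimension of reduced homology `H̃_{j-1}(Δ; K)` of a collection `Δ` of finite sets. -/
noncomputable def rhd0 (Δ : Set (Finset ℕ)) (j : ℕ) : ℕ := rhd K (lab Δ) j

/-- Dimension of reduced homology `H̃_j(Δ; K)`, `j : ℤ`. -/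
noncomputable def hdim0 (Δ : Set (Finset ℕ)) (j : ℤ) : ℕ := hdim K (lab Δ) j

end Homology

/-! ## Monomial ideals in `k[x_1, …, x_n]`, invariant under the symmetric group -/

section Poly

variable (K : Type) [Field K] (n : ℕ)

/-- The monomial `x^a` in `k[x_1, …, x_n]`. -/
noncomputable def mon (a : Fin n → ℕ) : MvPolynomial (Fin n) K :=
  MvPolynomial.monomial (Finsupp.equivFunOnFinite.symm a) 1

/-- A monomial ideal: an ideal generated by a set of monomials. -/
def IsMonomialIdeal (I : Ideal (MvPolynomial (Fin n) K)) : Prop :=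
  ∃ S : Set (Fin n → ℕ), I = Ideal.span (mon K n '' S)

/-- `I` is invariant under the action of `S_n` permuting the variables. -/
def IsSymmetricIdeal (I : Ideal (MvPolynomial (Fin n) K)) : Prop :=
  ∀ σ : Equiv.Perm (Fin n), Ideal.map (MvPolynomial.rename σ).toRingHom I = I

end Poly

/-! ## Partitions given by blocks `(d_1^{p_1}, …, d_s^{p_s}, 0^{p_{s+1}})` -/

section Blocks

/-- `cumsum p k = p 0 + ⋯ + p (k-1)`. -/
def cumsum (p : ℕ → ℕ) (k : ℕ) : ℕ := ∑ j ∈ Finset.range k, p j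

/-- The index of the block (among blocks `0, …, s`) containing position `i`,
for blocks of sizes `p 0, …, p (s-1)` followed by a final block. -/
def blkOf (p : ℕ → ℕ) (s i : ℕ) : ℕ :=
  ((Finset.range s).filter fun k => cumsum p (k + 1) ≤ i).card

/-- The partition `μ = (d_0^{p_0}, …, d_{s-1}^{p_{s-1}}, 0^{p_s})` (0-indexed blocks),
as a function of the position `i ∈ {0, …, n-1}` where `n = cumsum p (s+1)`. -/
def muOf (s : ℕ) (d p : ℕ → ℕ) (i : ℕ) : ℕ :=
  if blkOf p s i < s then d (blkOf p s i) else 0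

/-- The partition `μ ∖ c`, obtained from `μ` by replacing, for each `k`, the last `c k` of
the parts equal to `d k` by `d k - 1`. -/
def muMinus (s : ℕ) (d p c : ℕ → ℕ) (i : ℕ) : ℕ :=
  if blkOf p s i < s then
    (if p (blkOf p s i) - c (blkOf p s i) ≤ i - cumsum p (blkOf p s i) then
      d (blkOf p s i) - 1 else d (blkOf p s i))
  else 0

/-- Indicator vector of a finite set `F`. -/
def eF (F : Finset ℕ) (j : ℕ) : ℕ := if j ∈ F then 1 else 0

end Blocks

/-! ## The simplicial complexes `Δ^{μ,c}(I)` and `Γ^{μ,c}(I)` -/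

section Complexes

variable (K : Type) [Field K] (n : ℕ)

/-- The simplicial complex `Δ^{μ,c}(I) = {F ⊆ [s] : μ ∖ (c + e_F) ∈ P(I)}` (vertices are
`0, …, s-1`), for `μ = (d_0^{p_0}, …, d_{s-1}^{p_{s-1}}, 0^{p_s})` and `c ≤ p(μ)`. -/
def DeltaCx (I : Ideal (MvPolynomial (Fin n) K)) (s : ℕ) (d p c : ℕ → ℕ) :
    Set (Finset ℕ) :=
  {F | F ⊆ Finset.range s ∧
    mon K n (fun i => muMinus s d p (fun j => c j + eF F j) i.val) ∈ I}

/-- The Alexander dual complex `Γ^{μ,c}(I) = {F ⊆ [s] : μ ∖ (c + e_{[s]∖F}) ∈ O(I)}`. -/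
def GammaCx (I : Ideal (MvPolynomial (Fin n) K)) (s : ℕ) (d p c : ℕ → ℕ) :
    Set (Finset ℕ) :=
  {F | F ⊆ Finset.range s ∧
    mon K n (fun i => muMinus s d p
      (fun j => c j + (if j < s ∧ j ∉ F then 1 else 0)) i.val) ∉ I}

/-- `γ_i^{μ,c}(I) = dim_K H̃_{i-1}(Δ^{μ,c}(I); K)`. -/
noncomputable def gammaDim (I : Ideal (MvPolynomial (Fin n) K)) (s : ℕ) (d p c : ℕ → ℕ)
    (i : ℕ) : ℕ :=
  rhd0 K (DeltaCx K n I s d p c) i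

end Complexes

/-! ## Multigraded Tor via the Koszul complex

For a monomial ideal `I`, the multidegree-`a` strand of the Koszul complex `K_•(I)` is the
(shifted) reduced chain complex of the simplicial complex
`Δ_a^I = {F ⊆ [n] : a - e_F ≥ 0, x^{a - e_F} ∈ I}`, so that
`dim_K Tor_i(I, K)_a = dim_K H̃_{i-1}(Δ_a^I; K)`, and similarly for `R/I` with the
condition `x^{a-e_F} ∉ I`. -/

section Tor

variable (K : Type) [Field K] (n : ℕ)

/-- The Koszul simplicial complex of the ideal `I` in multidegree `a`. -/
def KosI (I : Ideal (MvPolynomial (Fin n) K)) (a : Fin n → ℕ) : Set (Finset ℕ) :=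
  {F | F ⊆ Finset.range n ∧ (∀ i : Fin n, (i : ℕ) ∈ F → 1 ≤ a i) ∧
    mon K n (fun i => a i - eF F i.val) ∈ I}

/-- The Koszul complex of `R/I` in multidegree `a`. -/
def KosQ (I : Ideal (MvPolynomial (Fin n) K)) (a : Fin n → ℕ) : Set (Finset ℕ) :=
  {F | F ⊆ Finset.range n ∧ (∀ i : Fin n, (i : ℕ) ∈ F → 1 ≤ a i) ∧
    mon K n (fun i => a i - eF F i.val) ∉ I}

/-- `dim_K Tor_i(I, K)_a`, for a monomial ideal `I` and a multidegree `a ∈ ℤ^n`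
(components with a negative coordinate vanish, so only `a ∈ ℕ^n` is needed). -/
noncomputable def torDim (I : Ideal (MvPolynomial (Fin n) K)) (i : ℕ) (a : Fin n → ℕ) : ℕ :=
  rhd0 K (KosI K n I a) i

/-- `dim_K Tor_i(R/I, K)_a` for a monomial ideal `I`. -/
noncomputable def torQDim (I : Ideal (MvPolynomial (Fin n) K)) (i : ℕ) (a : Fin n → ℕ) : ℕ :=
  rhd0 K (KosQ K n I a) i

/-- `dim_K Tor_i(I, K)_{⟨μ⟩}`: the sum of `dim_K Tor_i(I, K)_a` over all rearrangements `a`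
of the partition `μ`. -/
noncomputable def torDimSym (I : Ideal (MvPolynomial (Fin n) K)) (i : ℕ) (μ : Fin n → ℕ) : ℕ :=
  ∑ a ∈ Finset.image (fun σ : Equiv.Perm (Fin n) => μ ∘ σ) Finset.univ, torDim K n I i a

/-- `dim_K Tor_i(R/I, K)_{⟨μ⟩}`. -/
noncomputable def torQDimSym (I : Ideal (MvPolynomial (Fin n) K)) (i : ℕ) (μ : Fin n → ℕ) : ℕ :=
  ∑ a ∈ Finset.image (fun σ : Equiv.Perm (Fin n) => μ ∘ σ) Finset.univ, torQDim K n I i a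

end Tor

/-! ## Extended partitions in `P_n^∞` and the dual generators of an `S_n`-invariant
monomial ideal -/

section ExtendedPartitions

variable (K : Type) [Field K] (n : ℕ)

/-- `ℓ(μ)`: the number of entries of `μ ∈ P_n^∞` equal to `∞`. -/
def ellInf (μ : Fin n → ℕ∞) : ℕ := (Finset.univ.filter fun i => μ i = ⊤).card

/-- The largest finite entry of `μ ∈ P_n^∞` (i.e. the first finite entry, `μ` being
weakly decreasing). -/
def topVal (μ : Fin n → ℕ∞) : ℕ := Finset.univ.sup fun i => (μ i).toNat

/-- `μ^+ ∈ P_n`: each `∞` entry of `μ` is replaced by (largest finite entry)` + 1`. -/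
def plusOf (μ : Fin n → ℕ∞) (i : Fin n) : ℕ :=
  if μ i = ⊤ then topVal n μ + 1 else (μ i).toNat

/-- `μ̃ = μ^+ + (0^{ℓ(μ)}, 1^{n - ℓ(μ)}) ∈ P_n`. -/
def tildeOf (μ : Fin n → ℕ∞) (i : Fin n) : ℕ :=
  if μ i = ⊤ then topVal n μ + 1 else (μ i).toNat + 1

/-- The ideal `Q_μ = ∩_{σ ∈ S_n} σ((x_k^{μ_k + 1}, …, x_n^{μ_n + 1}))`, where
`μ_k, …, μ_n` are the finite entries of `μ ∈ P_n^∞`. -/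
noncomputable def Qgen (μ : Fin n → ℕ∞) : Ideal (MvPolynomial (Fin n) K) :=
  ⨅ σ : Equiv.Perm (Fin n),
    Ideal.map (MvPolynomial.rename σ).toRingHom
      (Ideal.span {g | ∃ i : Fin n, μ i ≠ ⊤ ∧ g = MvPolynomial.X i ^ ((μ i).toNat + 1)})

/-- `Λ` is the (finite) set of dual generators of `I`, i.e. `I = ∩_{μ ∈ Λ} Q_μ` is the
irredundant presentation of `I` by ideals `Q_μ`. -/
def IsDualPresentation (I : Ideal (MvPolynomial (Fin n) K))
    (Λ : Finset (Fin n → ℕ∞)) : Prop :=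
  (∀ μ ∈ Λ, Antitone μ) ∧ (I = ⨅ μ ∈ Λ, Qgen K n μ) ∧
    ∀ μ ∈ Λ, I ≠ ⨅ ρ ∈ Λ, ⨅ _ : ρ ≠ μ, Qgen K n ρ

/-- The partial order `≼` on dual generators: `μ ≼ ρ` iff `μ̃ ≤ ρ̃` (componentwise) and
`ℓ(μ) - ℓ(ρ) ≤ |ρ̃| - |μ̃|`. -/
def preceq (μ ρ : Fin n → ℕ∞) : Prop :=
  (∀ i, tildeOf n μ i ≤ tildeOf n ρ i) ∧
    (∑ i, tildeOf n μ i) + ellInf n μ ≤ (∑ i, tildeOf n ρ i) + ellInf n ρ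

/-- The extended partition `ρ = (∞^{p_0}, d_1^{p_1}, …, d_s^{p_s}) ∈ P_n^∞`
(so `n = p 0 + p 1 + ⋯ + p s`), as a function of the position `i ∈ {0, …, n-1}`. -/
def rhoOf (s : ℕ) (d p : ℕ → ℕ) (i : ℕ) : ℕ∞ :=
  if blkOf p (s + 1) i = 0 then ⊤ else ((d (blkOf p (s + 1) i) : ℕ) : ℕ∞)

end ExtendedPartitions

/-- Extend `c : (k : Fin s) → Fin (p k)` (i.e. a vector `0 ≤ c ≤ p(μ)`) to a
function `ℕ → ℕ`. -/
def cExt (s : ℕ) (p : ℕ → ℕ) (c : (k : Fin s) → Fin (p k)) (j : ℕ) : ℕ :=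
  if h : j < s then (c ⟨j, h⟩ : ℕ) else 0

/-! ## The simplicial chain complex inside the space of all finite sets of vertices -/

section Chains

variable (K : Type) [Field K]

/-- The sign of the vertex `v` relative to the finite set `F`. -/
def sgn (v : ℕ) (F : Finset ℕ) : K := ∏ u ∈ F, if u < v then -1 else 1

/-- The boundary operator on formal combinations of finite sets. -/
def bdry : (Finset ℕ →₀ K) →ₗ[K] (Finset ℕ →₀ K) :=
  Finsupp.linearCombination K fun F => ∑ v ∈ F, Finsupp.single (F.erase v) (sgn K v F)

/-- Exterior multiplication by the vertex `w`. -/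
def wedge (w : ℕ) : (Finset ℕ →₀ K) →ₗ[K] (Finset ℕ →₀ K) :=
  Finsupp.linearCombination K fun F => if w ∈ F then 0 else Finsupp.single (insert w F) (sgn K w F)

/-- Contraction against the vertex `w`. -/
def contract (w : ℕ) : (Finset ℕ →₀ K) →ₗ[K] (Finset ℕ →₀ K) :=
  Finsupp.linearCombination K fun F => if w ∈ F then Finsupp.single (F.erase w) (sgn K w F) else 0

variable {K}

lemma sgn_insert {v w : ℕ} {F : Finset ℕ} (h : w ∉ F) :
    sgn K v (insert w F) = (if w < v then -1 else 1) * sgn K v F := by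
  simp [sgn, Finset.prod_insert h]

lemma sgn_mul_self (v : ℕ) (F : Finset ℕ) : sgn K v F * sgn K v F = 1 := by
  rw [sgn, ← Finset.prod_mul_distrib]
  exact Finset.prod_eq_one fun u _ => by split_ifs <;> simp

lemma sgn_insert_self {w : ℕ} {F : Finset ℕ} (h : w ∉ F) :
    sgn K w (insert w F) = sgn K w F := by
  simp [sgn_insert h]

lemma neg_one_pow_card_filter {v : ℕ} {F : Finset ℕ} (h : v ∈ F) :
    (-1 : K) ^ (F.filter fun u => u ≤ v).card = -sgn K v F := by
  obtain ⟨G, hG, rfl⟩ : ∃ G, v ∉ G ∧ insert v G = F :=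
    ⟨F.erase v, Finset.notMem_erase v F, Finset.insert_erase h⟩
  rw [sgn_insert_self hG, Finset.filter_insert, if_pos le_rfl, Finset.card_insert_of_notMem
    (fun hv => hG (Finset.mem_filter.mp hv).1), pow_succ, mul_neg_one, sgn,
    Finset.prod_ite, Finset.prod_const_one, mul_one, Finset.prod_const]
  congr 3
  refine Finset.filter_congr fun u hu => ?_
  have : u ≠ v := by rintro rfl; exact hG hu
  omega

lemma bdry_single (F : Finset ℕ) (a : K) :
    bdry K (Finsupp.single F a) = ∑ v ∈ F, Finsupp.single (F.erase v) (a * sgn K v F) := by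
  simp [bdry, Finset.smul_sum]

lemma wedge_single_of_mem {w : ℕ} {F : Finset ℕ} (h : w ∈ F) (a : K) :
    wedge K w (Finsupp.single F a) = 0 := by
  simp [wedge, h]

lemma wedge_single_of_notMem {w : ℕ} {F : Finset ℕ} (h : w ∉ F) (a : K) :
    wedge K w (Finsupp.single F a) = Finsupp.single (insert w F) (a * sgn K w F) := by
  simp [wedge, h]

lemma bdry_wedge_single (w : ℕ) (F : Finset ℕ) (a : K) :
    bdry K (wedge K w (Finsupp.single F a)) + wedge K w (bdry K (Finsupp.single F a)) =
      Finsupp.single F a := by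
  by_cases h : w ∈ F
  · rw [wedge_single_of_mem h, map_zero, zero_add, bdry_single, map_sum,
      Finset.sum_eq_single_of_mem w h]
    · obtain ⟨G, hG, rfl⟩ : ∃ G, w ∉ G ∧ insert w G = F :=
        ⟨F.erase w, Finset.notMem_erase w F, Finset.insert_erase h⟩
      rw [Finset.erase_insert hG, wedge_single_of_notMem hG, sgn_insert_self hG, mul_assoc,
        sgn_mul_self, mul_one]
    · intro v _ hvw
      exact wedge_single_of_mem (Finset.mem_erase.mpr ⟨hvw.symm, h⟩) _
  · rw [wedge_single_of_notMem h, bdry_single, bdry_single, Finset.sum_insert h,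
      Finset.erase_insert h, sgn_insert_self h, mul_assoc, sgn_mul_self, mul_one, map_sum,
      add_assoc, ← Finset.sum_add_distrib, add_eq_left]
    refine Finset.sum_eq_zero fun v hv => ?_
    have hvw : v ≠ w := by rintro rfl; exact h hv
    obtain ⟨G, hG, rfl⟩ : ∃ G, v ∉ G ∧ insert v G = F :=
      ⟨F.erase v, Finset.notMem_erase v F, Finset.insert_erase hv⟩
    have hw : w ∉ G := fun hw => h (Finset.mem_insert_of_mem hw)
    rw [Finset.erase_insert hG, wedge_single_of_notMem hw, Finset.insert_comm,
      Finset.erase_insert (by simp [hvw, hG]), ← Finsupp.single_add, sgn_insert hG,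
      Finset.insert_comm, sgn_insert h, sgn_insert_self hG]
    rw [Finsupp.single_eq_zero]
    rcases lt_or_gt_of_ne hvw with h' | h'
    · rw [if_pos h', if_neg (lt_asymm h')]; ring
    · rw [if_neg (lt_asymm h'), if_pos h']; ring

lemma bdry_wedge (w : ℕ) (x : Finset ℕ →₀ K) :
    bdry K (wedge K w x) + wedge K w (bdry K x) = x := by
  induction x using Finsupp.induction_linear with
  | zero => simp
  | add x y hx hy =>
    simp only [map_add]
    nth_rewrite 3 [← hx]
    nth_rewrite 3 [← hy]
    abel
  | single F a => exact bdry_wedge_single w F a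

lemma bdry_bdry_single (F : Finset ℕ) (a : K) : bdry K (bdry K (Finsupp.single F a)) = 0 := by
  induction F using Finset.induction_on generalizing a with
  | empty => simp [bdry_single]
  | insert w F h ih =>
    have h1 : Finsupp.single (insert w F) a = wedge K w (Finsupp.single F (a * sgn K w F)) := by
      rw [wedge_single_of_notMem h, mul_assoc, sgn_mul_self, mul_one]
    have h2 := bdry_wedge w (Finsupp.single F (a * sgn K w F))
    have h3 := bdry_wedge w (bdry K (Finsupp.single F (a * sgn K w F)))
    rw [ih, map_zero, add_zero] at h3
    rw [h1, eq_sub_of_add_eq h2, map_sub, h3, sub_self]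

lemma bdry_bdry (x : Finset ℕ →₀ K) : bdry K (bdry K x) = 0 := by
  induction x using Finsupp.induction_linear with
  | zero => simp
  | add x y hx hy => simp [hx, hy]
  | single F a => exact bdry_bdry_single F a

/-- Exterior multiplication by the difference of the vertices `u` and `w`
anticommutes with the boundary. -/
lemma bdry_wedge_sub (u w : ℕ) :
    bdry K ∘ₗ (wedge K u - wedge K w) = -((wedge K u - wedge K w) ∘ₗ bdry K) := by
  ext1 F
  ext1
  simp only [LinearMap.comp_apply, LinearMap.sub_apply, LinearMap.neg_apply, map_sub,
    Finsupp.lsingle_apply]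
  have hu := bdry_wedge u (Finsupp.single F (1 : K))
  have hw := bdry_wedge w (Finsupp.single F (1 : K))
  rw [eq_sub_of_add_eq hu, eq_sub_of_add_eq hw]
  abel

variable (K) in
/-- Formal combinations of finite sets avoiding `u`. -/
def avoiding (u : ℕ) : Submodule K (Finset ℕ →₀ K) := Finsupp.supported K K {F | u ∉ F}

lemma linearMap_ext_on_supported {S : Set (Finset ℕ)} {N : Type*} [AddCommGroup N] [Module K N]
    {f g : (Finset ℕ →₀ K) →ₗ[K] N} (h : ∀ F ∈ S, f (Finsupp.single F 1) = g (Finsupp.single F 1))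
    {x : Finset ℕ →₀ K} (hx : x ∈ Finsupp.supported K K S) : f x = g x := by
  rw [Finsupp.supported_eq_span_single] at hx
  refine LinearMap.eqOn_span (s := (fun i => Finsupp.single i (1 : K)) '' S) ?_ hx
  rintro _ ⟨F, hF, rfl⟩
  exact h F hF

lemma map_supported_le {S : Set (Finset ℕ)} {N : Type*} [AddCommGroup N] [Module K N]
    {f : (Finset ℕ →₀ K) →ₗ[K] N} {B : Submodule K N}
    (h : ∀ F ∈ S, f (Finsupp.single F 1) ∈ B) :
    (Finsupp.supported K K S).map f ≤ B := by
  rw [Finsupp.supported_eq_span_single, Submodule.map_span, Submodule.span_le]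
  rintro _ ⟨_, ⟨F, hF, rfl⟩, rfl⟩
  exact h F hF

lemma contract_of_avoiding {u : ℕ} {x : Finset ℕ →₀ K} (hx : x ∈ avoiding K u) :
    contract K u x = 0 := by
  refine linearMap_ext_on_supported (g := 0) (fun F hF => ?_) hx
  have : u ∉ F := hF
  simp [contract, this]

lemma contract_wedge_sub {u w : ℕ} (huw : u ≠ w) {x : Finset ℕ →₀ K} (hx : x ∈ avoiding K u) :
    contract K u ((wedge K u - wedge K w) x) = x := by
  refine linearMap_ext_on_supported (f := contract K u ∘ₗ (wedge K u - wedge K w))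
    (g := LinearMap.id) (fun F hF => ?_) hx
  have hu : u ∉ F := hF
  have h0 : contract K u (wedge K w (Finsupp.single F 1)) = 0 := by
    by_cases hw : w ∈ F
    · rw [wedge_single_of_mem hw, map_zero]
    · rw [wedge_single_of_notMem hw]
      refine contract_of_avoiding (Finsupp.single_mem_supported K _ ?_)
      simp [huw, hu]
  simp only [LinearMap.comp_apply, LinearMap.sub_apply, map_sub, h0, sub_zero,
    wedge_single_of_notMem hu, LinearMap.id_apply]
  simp [contract, Finset.erase_insert hu, sgn_insert_self hu, sgn_mul_self]

lemma bdry_mem_avoiding (u : ℕ) : (avoiding K u).map (bdry K) ≤ avoiding K u := by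
  refine map_supported_le fun F hF => ?_
  rw [bdry_single]
  exact Submodule.sum_mem _ fun v _ => Finsupp.single_mem_supported K _
    fun h => hF (Finset.mem_of_mem_erase h)

lemma finrank_sup_map_wedge_sub {u w : ℕ} (huw : u ≠ w) {A B : Submodule K (Finset ℕ →₀ K)}
    [FiniteDimensional K A] [FiniteDimensional K B] (hA : A ≤ avoiding K u)
    (hB : B ≤ avoiding K u) :
    Module.finrank K ↥(A ⊔ B.map (wedge K u - wedge K w)) =
      Module.finrank K A + Module.finrank K B := by
  have hinf : A ⊓ B.map (wedge K u - wedge K w) = ⊥ := by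
    rw [eq_bot_iff]
    rintro _ ⟨hxA, y, hy, rfl⟩
    have h1 := contract_of_avoiding (hA hxA)
    rw [contract_wedge_sub huw (hB hy)] at h1
    simp [h1]
  have hB' : Module.finrank K (B.map (wedge K u - wedge K w)) = Module.finrank K B := by
    rw [← LinearMap.range_domRestrict]
    refine LinearMap.finrank_range_of_inj fun x y hxy => Subtype.ext ?_
    rw [← contract_wedge_sub huw (hB x.2), ← contract_wedge_sub huw (hB y.2)]
    exact congrArg _ hxy
  have := Submodule.finrank_sup_add_finrank_inf_eq A (B.map (wedge K u - wedge K w))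
  rw [hinf, finrank_bot, hB'] at this
  simpa using this

variable (K) in
/-- The chains of `Δ` on faces with `j` elements. -/
def chn (Δ : Set (Finset ℕ)) (j : ℤ) : Submodule K (Finset ℕ →₀ K) :=
  Finsupp.supported K K {F | F ∈ Δ ∧ (F.card : ℤ) = j}

variable (K) in
/-- The dimension of the reduced homology of `Δ` in degree `j - 1`. -/
def hz (Δ : Set (Finset ℕ)) (j : ℤ) : ℤ :=
  Module.finrank K (chn K Δ j) - Module.finrank K ((chn K Δ j).map (bdry K)) -
    Module.finrank K ((chn K Δ (j + 1)).map (bdry K))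

lemma finiteDimensional_chn {Δ : Set (Finset ℕ)} (hΔ : Δ.Finite) (j : ℤ) :
    FiniteDimensional K (chn K Δ j) := by
  rw [chn, Finsupp.supported_eq_span_single]
  exact FiniteDimensional.span_of_finite K ((hΔ.subset fun F hF => hF.1).image _)

/-- Faces of `Δ` not containing `u`. -/
def del (Δ : Set (Finset ℕ)) (u : ℕ) : Set (Finset ℕ) := {F | F ∈ Δ ∧ u ∉ F}

/-- The link of the vertex `u` in `Δ`. -/
def lnk (Δ : Set (Finset ℕ)) (u : ℕ) : Set (Finset ℕ) := {F | insert u F ∈ Δ ∧ u ∉ F}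

lemma chn_eq_sup {Δ : Set (Finset ℕ)} {u w : ℕ} (huw : u ≠ w)
    (hΔ : ∀ G, u ∉ G → w ∉ G → insert u G ∈ Δ → insert w G ∈ Δ) (j : ℤ) :
    chn K Δ j = chn K (del Δ u) j ⊔ (chn K (lnk Δ u) (j - 1)).map (wedge K u - wedge K w) := by
  have hw : ∀ G, u ∉ G → insert u G ∈ Δ → (G.card : ℤ) = j - 1 → ∀ a : K,
      wedge K w (Finsupp.single G a) ∈ chn K (del Δ u) j := by
    intro G hu hG hc a
    by_cases h : w ∈ G
    · rw [wedge_single_of_mem h]; exact Submodule.zero_mem _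
    · rw [wedge_single_of_notMem h]
      refine Finsupp.single_mem_supported K _ ⟨⟨hΔ G hu h hG, by simp [huw, hu]⟩, ?_⟩
      rw [Finset.card_insert_of_notMem h]; push_cast; omega
  have hdel : chn K (del Δ u) j ≤ chn K Δ j :=
    Finsupp.supported_mono fun F hF => ⟨hF.1.1, hF.2⟩
  apply le_antisymm
  · have := map_supported_le (K := K) (S := {F | F ∈ Δ ∧ (F.card : ℤ) = j}) (f := LinearMap.id)
      (B := chn K (del Δ u) j ⊔ (chn K (lnk Δ u) (j - 1)).map (wedge K u - wedge K w)) ?_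
    · simpa [chn] using this
    rintro F ⟨hF, hc⟩
    rw [LinearMap.id_apply]
    by_cases hu : u ∈ F
    · obtain ⟨G, hG, rfl⟩ : ∃ G, u ∉ G ∧ insert u G = F :=
        ⟨F.erase u, Finset.notMem_erase u F, Finset.insert_erase hu⟩
      rw [Finset.card_insert_of_notMem hG] at hc
      have hc' : (G.card : ℤ) = j - 1 := by push_cast at hc; omega
      have h1 : Finsupp.single (insert u G) (1 : K) =
          wedge K w (Finsupp.single G (sgn K u G)) +
            (wedge K u - wedge K w) (Finsupp.single G (sgn K u G)) := by
        rw [LinearMap.sub_apply, wedge_single_of_notMem hG, sgn_mul_self]; abel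
      rw [h1]
      refine Submodule.add_mem_sup (hw G hG hF hc' _) (Submodule.mem_map_of_mem ?_)
      exact Finsupp.single_mem_supported K _ ⟨⟨hF, hG⟩, hc'⟩
    · exact Submodule.mem_sup_left (Finsupp.single_mem_supported K _ ⟨⟨hF, hu⟩, hc⟩)
  · refine sup_le hdel (map_supported_le ?_)
    rintro G ⟨⟨hG, hu⟩, hc⟩
    rw [LinearMap.sub_apply]
    refine Submodule.sub_mem _ ?_ (hdel (hw G hu hG hc 1))
    rw [wedge_single_of_notMem hu]
    refine Finsupp.single_mem_supported K _ ⟨hG, ?_⟩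
    rw [Finset.card_insert_of_notMem hu]; push_cast; omega

/-- If the vertex `u` of `Δ` can always be replaced by `w`, the homology of `Δ` splits as the
homology of the deletion of `u` and the shifted homology of the link of `u`. -/
lemma hz_eq_add {Δ : Set (Finset ℕ)} (hfin : Δ.Finite) {u w : ℕ} (huw : u ≠ w)
    (hΔ : ∀ G, u ∉ G → w ∉ G → insert u G ∈ Δ → insert w G ∈ Δ) (j : ℤ) :
    hz K Δ j = hz K (del Δ u) j + hz K (lnk Δ u) (j - 1) := by
  have hd : (del Δ u).Finite := hfin.subset fun F hF => hF.1
  have hl : (lnk Δ u).Finite := by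
    refine Set.Finite.of_finite_image (f := insert u) (hfin.subset ?_) ?_
    · rintro _ ⟨F, hF, rfl⟩; exact hF.1
    · intro F hF G hG h
      rw [← Finset.erase_insert hF.2, ← Finset.erase_insert hG.2]
      exact congrArg (fun s => s.erase u) h
  have fd := fun j => finiteDimensional_chn (K := K) hd j
  have fl := fun j => finiteDimensional_chn (K := K) hl j
  have ad : ∀ j, chn K (del Δ u) j ≤ avoiding K u := fun j =>
    Finsupp.supported_mono fun F hF => hF.1.2
  have al : ∀ j, chn K (lnk Δ u) j ≤ avoiding K u := fun j =>
    Finsupp.supported_mono fun F hF => hF.1.2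
  have h1 : ∀ j, Module.finrank K (chn K Δ j) = Module.finrank K (chn K (del Δ u) j) +
      Module.finrank K (chn K (lnk Δ u) (j - 1)) := fun j => by
    rw [chn_eq_sup huw hΔ, finrank_sup_map_wedge_sub huw (ad j) (al _)]
  have h2 : ∀ j, Module.finrank K ((chn K Δ j).map (bdry K)) =
      Module.finrank K ((chn K (del Δ u) j).map (bdry K)) +
      Module.finrank K ((chn K (lnk Δ u) (j - 1)).map (bdry K)) := fun j => by
    rw [chn_eq_sup huw hΔ, Submodule.map_sup, ← Submodule.map_comp, bdry_wedge_sub,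
      Submodule.map_neg, Submodule.map_comp, finrank_sup_map_wedge_sub huw
      ((Submodule.map_mono (ad j)).trans (bdry_mem_avoiding u))
      ((Submodule.map_mono (al _)).trans (bdry_mem_avoiding u))]
  rw [hz, hz, hz, h1, h2, h2, show j + 1 - 1 = j - 1 + 1 by ring]
  push_cast
  ring

end Chains

section Comparison

variable {K : Type} [Field K] {Δ : Set (Finset ℕ)}

variable (K Δ) in
/-- The embedding of the simplicial chains of `Δ` into formal combinations of finite sets. -/
def chainEmb (j : ℕ) : (ChainIdx (lab Δ) j →₀ K) →ₗ[K] (Finset ℕ →₀ K) :=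
  Finsupp.lmapDomain K K fun q => q.1.2

lemma chainEmb_injective (j : ℕ) : Function.Injective (chainEmb K Δ j) :=
  Finsupp.mapDomain_injective fun _ _ h => Subtype.ext (Prod.ext rfl h)

lemma range_chainEmb (j : ℕ) : LinearMap.range (chainEmb K Δ j) = chn K Δ j := by
  rw [LinearMap.range_eq_map, ← Finsupp.supported_univ, chainEmb, Finsupp.lmapDomain_supported,
    chn]
  congr 1
  ext F
  simp only [Set.image_univ, Set.mem_range, Set.mem_ofPred_eq]
  constructor
  · rintro ⟨q, rfl⟩
    exact ⟨q.2.1, by exact_mod_cast q.2.2⟩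
  · rintro ⟨h, hc⟩
    exact ⟨⟨((), F), h, by exact_mod_cast hc⟩, rfl⟩

lemma chainEmb_single {j : ℕ} (q : ChainIdx (lab Δ) j) (a : K) :
    chainEmb K Δ j (Finsupp.single q a) = Finsupp.single q.1.2 a :=
  Finsupp.mapDomain_single

lemma chainEmb_bd (hdown : ∀ F ∈ Δ, ∀ v, F.erase v ∈ Δ) (j : ℕ) :
    chainEmb K Δ j ∘ₗ bd K (lab Δ) j = -(bdry K ∘ₗ chainEmb K Δ (j + 1)) := by
  ext1 q
  ext1
  simp only [LinearMap.comp_apply, LinearMap.neg_apply, Finsupp.lsingle_apply, bd,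
    Finsupp.linearCombination_single, one_smul, bdElt, map_sum]
  rw [chainEmb_single, bdry_single, ← Finset.sum_neg_distrib]
  refine Finset.sum_congr rfl fun v hv => ?_
  have h : (q.1.1, q.1.2.erase v) ∈ lab Δ ∧ (q.1.2.erase v).card = j :=
    ⟨hdown _ q.2.1 v, by rw [Finset.card_erase_of_mem hv, q.2.2]; rfl⟩
  refine (congrArg (chainEmb K Δ j) (dif_pos h)).trans ?_
  refine ((chainEmb K Δ j).map_smul _ _).trans ?_
  refine (congrArg _ (chainEmb_single _ _)).trans ?_
  rw [neg_one_pow_card_filter hv, Finsupp.smul_single, ← Finsupp.single_neg]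
  simp

lemma finrank_range_bd (hdown : ∀ F ∈ Δ, ∀ v, F.erase v ∈ Δ) (j : ℕ) :
    Module.finrank K (LinearMap.range (bd K (lab Δ) j)) =
      Module.finrank K ((chn K Δ (j + 1)).map (bdry K)) := by
  have h := range_chainEmb (K := K) (Δ := Δ) (j + 1)
  push_cast at h
  rw [← h, ← LinearMap.range_comp, ← LinearMap.range_neg (bdry K ∘ₗ _),
    ← chainEmb_bd hdown, LinearMap.range_comp]
  exact LinearEquiv.finrank_eq (Submodule.equivMapOfInjective _ (chainEmb_injective j) _)

lemma bd_comp_bd (hdown : ∀ F ∈ Δ, ∀ v, F.erase v ∈ Δ) (j : ℕ) :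
    bd K (lab Δ) j ∘ₗ bd K (lab Δ) (j + 1) = 0 := by
  refine LinearMap.ext fun x => chainEmb_injective j ?_
  have h1 := LinearMap.congr_fun (chainEmb_bd (K := K) hdown j) (bd K (lab Δ) (j + 1) x)
  have h2 := LinearMap.congr_fun (chainEmb_bd (K := K) hdown (j + 1)) x
  simp only [LinearMap.comp_apply, LinearMap.neg_apply] at h1 h2
  rw [LinearMap.comp_apply, h1, h2, map_neg, bdry_bdry]
  simp

lemma map_bdry_chn_of_nonpos {j : ℤ} (hj : j ≤ 0) : (chn K Δ j).map (bdry K) = ⊥ := by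
  rw [eq_bot_iff]
  refine map_supported_le fun F hF => ?_
  have h : F = ∅ := by
    rw [← Finset.card_eq_zero]
    have := hF.2
    omega
  simp [h, bdry_single]

lemma chn_of_neg {j : ℤ} (hj : j < 0) : chn K Δ j = ⊥ := by
  have h : {F | F ∈ Δ ∧ (F.card : ℤ) = j} = (∅ : Set (Finset ℕ)) :=
    Set.eq_empty_of_forall_notMem fun F hF => by have := hF.2; omega
  rw [chn, h, Finsupp.supported_empty]

lemma rhd_eq_hz (hfin : Δ.Finite) (hdown : ∀ F ∈ Δ, ∀ v, F.erase v ∈ Δ) (j : ℕ) :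
    (rhd K (lab Δ) j : ℤ) = hz K Δ j := by
  have fin : ∀ j : ℕ, FiniteDimensional K (ChainIdx (lab Δ) j →₀ K) := fun j => by
    have := finiteDimensional_chn (K := K) hfin j
    rw [← range_chainEmb] at this
    exact Module.Finite.equiv (LinearEquiv.ofInjective _ (chainEmb_injective j)).symm
  have := fin j
  have hle : LinearMap.range (bd K (lab Δ) j) ≤ cycles K (lab Δ) j := by
    cases j with
    | zero => exact le_top
    | succ j => exact LinearMap.range_le_ker_iff.mpr (bd_comp_bd hdown j)
  have hcyc : (Module.finrank K (cycles K (lab Δ) j) : ℤ) =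
      Module.finrank K (chn K Δ j) - Module.finrank K ((chn K Δ j).map (bdry K)) := by
    rw [← range_chainEmb, LinearMap.finrank_range_of_inj (chainEmb_injective j)]
    cases j with
    | zero =>
      rw [range_chainEmb, map_bdry_chn_of_nonpos (by simp)]
      rw [show cycles K (lab Δ) 0 = ⊤ from rfl, finrank_top]
      simp
    | succ j =>
      have h1 : _ + Module.finrank K (cycles K (lab Δ) (j + 1)) = _ :=
        LinearMap.finrank_range_add_finrank_ker (bd K (lab Δ) j)
      rw [finrank_range_bd hdown] at h1
      rw [range_chainEmb]
      push_cast
      omega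
  have hsub := Submodule.finrank_mono hle
  rw [rhd, inf_eq_left.mpr hle, Nat.cast_sub hsub, hcyc, finrank_range_bd hdown, hz]

lemma hdim0_eq_hz (hfin : Δ.Finite) (hdown : ∀ F ∈ Δ, ∀ v, F.erase v ∈ Δ) (j : ℤ) :
    (hdim0 K Δ (j - 1) : ℤ) = hz K Δ j := by
  rw [hdim0, hdim, sub_add_cancel]
  split_ifs with hj
  · rw [rhd_eq_hz hfin hdown, Int.toNat_of_nonneg hj]
  · rw [hz, chn_of_neg (by omega), map_bdry_chn_of_nonpos (by omega)]
    simp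

end Comparison

section Reindex

variable (K : Type) [Field K]

/-- The sign of the rearrangement of the finite set `F` by `f`. -/
def permSign (f : ℕ → ℕ) (F : Finset ℕ) : K :=
  ∏ u ∈ F, ∏ v ∈ F, if u < v ∧ f v < f u then -1 else 1

/-- The signed reindexing of the vertices by `f`. -/
def reindex (f : ℕ → ℕ) : (Finset ℕ →₀ K) →ₗ[K] (Finset ℕ →₀ K) :=
  Finsupp.linearCombination K fun F => Finsupp.single (F.image f) (permSign K f F)

variable {K}

lemma permSign_mul_self (f : ℕ → ℕ) (F : Finset ℕ) :
    permSign K f F * permSign K f F = 1 := by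
  rw [permSign, ← Finset.prod_mul_distrib]
  refine Finset.prod_eq_one fun u _ => ?_
  rw [← Finset.prod_mul_distrib]
  exact Finset.prod_eq_one fun v _ => by split_ifs <;> simp

lemma permSign_insert {f : ℕ → ℕ} (hf : Function.Injective f) {v : ℕ} {G : Finset ℕ}
    (hv : v ∉ G) :
    permSign K f (insert v G) * sgn K (f v) (G.image f) =
      sgn K v G * permSign K f G := by
  rw [permSign, Finset.prod_insert hv, Finset.prod_insert hv]
  simp only [Finset.prod_insert hv, Finset.prod_mul_distrib]
  rw [sgn, sgn, Finset.prod_image hf.injOn, if_neg (by simp), one_mul]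
  have h : (∏ u ∈ G, if v < u ∧ f u < f v then (-1 : K) else 1) *
      (∏ u ∈ G, if u < v ∧ f v < f u then (-1 : K) else 1) *
      (∏ u ∈ G, if f u < f v then (-1 : K) else 1) = ∏ u ∈ G, if u < v then (-1 : K) else 1 := by
    rw [← Finset.prod_mul_distrib, ← Finset.prod_mul_distrib]
    refine Finset.prod_congr rfl fun u hu => ?_
    have h1 : u ≠ v := by rintro rfl; exact hv hu
    have h2 : f u ≠ f v := hf.ne h1
    rcases lt_or_gt_of_ne h1 with h3 | h3 <;> rcases lt_or_gt_of_ne h2 with h4 | h4 <;>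
      simp [h3, h4, lt_asymm h3, lt_asymm h4]
  rw [← h, permSign]
  ring

lemma reindex_single (f : ℕ → ℕ) (F : Finset ℕ) (a : K) :
    reindex K f (Finsupp.single F a) = Finsupp.single (F.image f) (a * permSign K f F) := by
  simp [reindex]

lemma bdry_reindex {f : ℕ → ℕ} (hf : Function.Injective f) :
    bdry K ∘ₗ reindex K f = reindex K f ∘ₗ bdry K := by
  ext1 F
  ext1
  simp only [LinearMap.comp_apply, Finsupp.lsingle_apply, reindex_single, bdry_single, map_sum]
  rw [Finset.sum_image hf.injOn]
  refine Finset.sum_congr rfl fun v hv => ?_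
  obtain ⟨G, hG, rfl⟩ : ∃ G, v ∉ G ∧ insert v G = F :=
    ⟨F.erase v, Finset.notMem_erase v F, Finset.insert_erase hv⟩
  have hfv : f v ∉ G.image f := by simpa [hf.eq_iff] using hG
  rw [Finset.erase_insert hG, Finset.image_insert, Finset.erase_insert hfv,
    sgn_insert_self hfv, sgn_insert_self hG, one_mul, one_mul, permSign_insert hf hG]

lemma reindex_injective {f : ℕ → ℕ} (hf : Function.Injective f) :
    Function.Injective (reindex K f) := by
  have h : reindex K f = Finsupp.lmapDomain K K (Finset.image f) ∘ₗ
      Finsupp.linearCombination K fun F => Finsupp.single F (permSign K f F) := by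
    ext1 F
    ext1
    simp [reindex_single, Finsupp.lmapDomain_apply]
  rw [h, LinearMap.coe_comp]
  refine (Finsupp.mapDomain_injective (Finset.image_injective hf)).comp ?_
  refine Function.Involutive.injective fun x => ?_
  induction x using Finsupp.induction_linear with
  | zero => simp
  | add x y hx hy => simp only [map_add, hx, hy]
  | single F a =>
    simp only [Finsupp.linearCombination_single, Finsupp.smul_single, smul_eq_mul]
    rw [mul_assoc, permSign_mul_self, mul_one]

lemma map_reindex_chn {f : ℕ → ℕ} (hf : Function.Injective f) (Δ : Set (Finset ℕ)) (j : ℤ) :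
    (chn K Δ j).map (reindex K f) = chn K (Finset.image f '' Δ) j := by
  apply le_antisymm
  · refine map_supported_le fun F hF => ?_
    rw [reindex_single]
    exact Finsupp.single_mem_supported K _
      ⟨⟨F, hF.1, rfl⟩, by rw [Finset.card_image_of_injective F hf]; exact hF.2⟩
  · have := map_supported_le (K := K)
      (S := {F | F ∈ Finset.image f '' Δ ∧ (F.card : ℤ) = j}) (f := LinearMap.id)
      (B := (chn K Δ j).map (reindex K f)) ?_
    · simpa [chn] using this
    rintro _ ⟨⟨F, hF, rfl⟩, hc⟩
    rw [Finset.card_image_of_injective F hf] at hc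
    refine ⟨Finsupp.single F (permSign K f F), Finsupp.single_mem_supported K _ ⟨hF, hc⟩, ?_⟩
    rw [reindex_single, permSign_mul_self, LinearMap.id_apply]

/-- Homology is invariant under injective reindexing of the vertices. -/
lemma hz_image {f : ℕ → ℕ} (hf : Function.Injective f) (Δ : Set (Finset ℕ)) (j : ℤ) :
    hz K (Finset.image f '' Δ) j = hz K Δ j := by
  have h1 : ∀ A : Submodule K (Finset ℕ →₀ K),
      Module.finrank K (A.map (reindex K f)) = Module.finrank K A := fun A =>
    (LinearEquiv.finrank_eq (Submodule.equivMapOfInjective _ (reindex_injective hf) A)).symm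
  have h2 : ∀ j, Module.finrank K ((chn K (Finset.image f '' Δ) j).map (bdry K)) =
      Module.finrank K ((chn K Δ j).map (bdry K)) := fun j => by
    rw [← map_reindex_chn hf, ← Submodule.map_comp, bdry_reindex hf, Submodule.map_comp, h1]
  rw [hz, hz, h2, h2, ← map_reindex_chn hf, h1]

end Reindex

/-! ## Complexes defined by the number of vertices of each colour -/

section Colored

/-- The number of elements of `F` of each colour. -/
def colorCount (b : ℕ → ℕ) (F : Finset ℕ) : ℕ → ℕ := fun k => (F.filter fun v => b v = k).card

/-- The sets of vertices in `V` whose colour counts, shifted by `c`, lie in `T`. -/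
def colored (T : Set (ℕ → ℕ)) (b : ℕ → ℕ) (V : Finset ℕ) (c : ℕ → ℕ) : Set (Finset ℕ) :=
  {F | F ⊆ V ∧ c + colorCount b F ∈ T}

lemma colorCount_insert {b : ℕ → ℕ} {u : ℕ} {G : Finset ℕ} (h : u ∉ G) :
    colorCount b (insert u G) = Pi.single (b u) 1 + colorCount b G := by
  funext k
  rw [Pi.add_apply, colorCount, Finset.filter_insert]
  split_ifs with hk
  · subst hk
    rw [Finset.card_insert_of_notMem (fun hu => h (Finset.mem_filter.mp hu).1), colorCount,
      Pi.single_eq_same, add_comm]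
  · rw [Pi.single_eq_of_ne (Ne.symm hk), colorCount, zero_add]

lemma finite_colored (T : Set (ℕ → ℕ)) (b : ℕ → ℕ) (V : Finset ℕ) (c : ℕ → ℕ) :
    (colored T b V c).Finite :=
  (Finset.finite_toSet V.powerset).subset fun _ hF => Finset.mem_coe.mpr
    (Finset.mem_powerset.mpr hF.1)

variable {K : Type} [Field K]

lemma hz_colored_insert (T : Set (ℕ → ℕ)) {b : ℕ → ℕ} {V : Finset ℕ} (c : ℕ → ℕ) {u w : ℕ}
    (hu : u ∉ V) (hw : w ∈ V) (hb : b u = b w) (j : ℤ) :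
    hz K (colored T b (insert u V) c) j =
      hz K (colored T b V c) j + hz K (colored T b V (c + Pi.single (b u) 1)) (j - 1) := by
  have huw : u ≠ w := by rintro rfl; exact hu hw
  rw [hz_eq_add (finite_colored T b _ c) huw]
  · congr 2
    · ext F
      constructor
      · rintro ⟨⟨hF, hT⟩, huF⟩
        exact ⟨(Finset.subset_insert_iff_of_notMem huF).mp hF, hT⟩
      · rintro ⟨hF, hT⟩
        exact ⟨⟨hF.trans (Finset.subset_insert _ _), hT⟩, fun h => hu (hF h)⟩
    · ext F
      constructor
      · rintro ⟨⟨hF, hT⟩, huF⟩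
        rw [colorCount_insert huF, ← add_assoc] at hT
        exact ⟨(Finset.insert_subset_insert_iff huF).mp hF, hT⟩
      · rintro ⟨hF, hT⟩
        have huF : u ∉ F := fun h => hu (hF h)
        refine ⟨⟨Finset.insert_subset_insert _ hF, ?_⟩, huF⟩
        rwa [colorCount_insert huF, ← add_assoc]
  · rintro G huG hwG ⟨hG, hT⟩
    refine ⟨Finset.insert_subset (Finset.mem_insert_of_mem hw)
      ((Finset.subset_insert _ _).trans hG), ?_⟩
    rwa [colorCount_insert hwG, ← hb, ← colorCount_insert huG]

lemma hz_colored_union (T : Set (ℕ → ℕ)) {b : ℕ → ℕ} {A R : Finset ℕ} (hAR : Disjoint A R)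
    (hb : ∀ u ∈ A, ∃ w ∈ R, b u = b w) (c : ℕ → ℕ) (j : ℤ) :
    hz K (colored T b (A ∪ R) c) j =
      ∑ B ∈ A.powerset, hz K (colored T b R (c + colorCount b B)) (j - B.card) := by
  induction A using Finset.induction_on generalizing c j with
  | empty =>
    have : colorCount b ∅ = 0 := by funext k; simp [colorCount]
    simp [this]
  | insert u A hu ih =>
    obtain ⟨w, hw, huw⟩ := hb u (Finset.mem_insert_self _ _)
    rw [Finset.disjoint_insert_left] at hAR
    have hb' : ∀ u ∈ A, ∃ w ∈ R, b u = b w := fun v hv => hb v (Finset.mem_insert_of_mem hv)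
    rw [Finset.insert_union, hz_colored_insert T c (by simp [hu, hAR.1])
      (Finset.mem_union_right _ hw) huw, ih hAR.2 hb', ih hAR.2 hb',
      Finset.sum_powerset_insert hu]
    congr 1
    refine Finset.sum_congr rfl fun B hB => ?_
    have huB : u ∉ B := fun h => hu (Finset.mem_powerset.mp hB h)
    rw [colorCount_insert huB, add_assoc, Finset.card_insert_of_notMem huB]
    congr 1
    push_cast
    ring

lemma card_filter_colorCount {s : ℕ} {b : ℕ → ℕ} {A : Finset ℕ} (hb : ∀ v ∈ A, b v < s)
    (c : ℕ → ℕ) :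
    (A.powerset.filter fun B => ∀ k < s, colorCount b B k = c k).card =
      ∏ k ∈ Finset.range s, (colorCount b A k).choose (c k) := by
  have h : ∏ k ∈ Finset.range s, (colorCount b A k).choose (c k) =
      ((Finset.range s).pi fun k => Finset.powersetCard (c k) (A.filter fun v => b v = k)).card := by
    rw [Finset.card_pi]
    exact Finset.prod_congr rfl fun k _ => (Finset.card_powersetCard _ _).symm
  rw [h]
  refine Finset.card_bij (fun B _ k _ => B.filter fun v => b v = k) ?_ ?_ ?_
  · intro B hB
    rw [Finset.mem_filter, Finset.mem_powerset] at hB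
    rw [Finset.mem_pi]
    intro k hk
    exact Finset.mem_powersetCard.mpr
      ⟨Finset.filter_subset_filter _ hB.1, hB.2 k (Finset.mem_range.mp hk)⟩
  · intro B hB B' hB' hBB
    rw [Finset.mem_filter, Finset.mem_powerset] at hB hB'
    ext v
    constructor
    · intro hv
      have := congrFun (congrFun hBB (b v)) (Finset.mem_range.mpr (hb v (hB.1 hv)))
      have hv' : v ∈ B.filter fun w => b w = b v := Finset.mem_filter.mpr ⟨hv, rfl⟩
      rw [this] at hv'
      exact (Finset.mem_filter.mp hv').1
    · intro hv
      have := congrFun (congrFun hBB (b v)) (Finset.mem_range.mpr (hb v (hB'.1 hv)))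
      have hv' : v ∈ B'.filter fun w => b w = b v := Finset.mem_filter.mpr ⟨hv, rfl⟩
      rw [← this] at hv'
      exact (Finset.mem_filter.mp hv').1
  · intro g hg
    rw [Finset.mem_pi] at hg
    have hg1 : ∀ k hk v, v ∈ g k hk → v ∈ A ∧ b v = k := fun k hk v hv =>
      Finset.mem_filter.mp ((Finset.mem_powersetCard.mp (hg k hk)).1 hv)
    have key : ∀ k (hk : k ∈ Finset.range s),
        ((A.filter fun v => ∃ hv : b v ∈ Finset.range s, v ∈ g (b v) hv).filter
          fun v => b v = k) = g k hk := by
      intro k hk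
      ext v
      simp only [Finset.mem_filter]
      constructor
      · rintro ⟨⟨_, hv, hvg⟩, rfl⟩; exact hvg
      · intro hv
        obtain ⟨h1, rfl⟩ := hg1 k hk v hv
        exact ⟨⟨h1, hk, hv⟩, rfl⟩
    refine ⟨A.filter fun v => ∃ hv : b v ∈ Finset.range s, v ∈ g (b v) hv, ?_, ?_⟩
    · rw [Finset.mem_filter, Finset.mem_powerset]
      refine ⟨Finset.filter_subset _ _, fun k hk => ?_⟩
      rw [colorCount, key k (Finset.mem_range.mpr hk)]
      exact (Finset.mem_powersetCard.mp (hg k _)).2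
    · funext k hk
      exact key k hk

lemma colorCount_mono (b : ℕ → ℕ) {F G : Finset ℕ} (h : F ⊆ G) (k : ℕ) :
    colorCount b F k ≤ colorCount b G k :=
  Finset.card_le_card (Finset.filter_subset_filter _ h)

lemma sum_colorCount {s : ℕ} {b : ℕ → ℕ} {F : Finset ℕ} (hb : ∀ v ∈ F, b v < s) :
    ∑ k ∈ Finset.range s, colorCount b F k = F.card :=
  (Finset.card_eq_sum_card_fiberwise fun v hv =>
    Finset.mem_coe.mpr (Finset.mem_range.mpr (hb v hv))).symm

lemma cExt_of_lt {s : ℕ} {p : ℕ → ℕ} (c : (k : Fin s) → Fin (p k)) {k : ℕ} (hk : k < s) :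
    cExt s p c k = c ⟨k, hk⟩ := dif_pos hk

lemma cExt_of_le {s : ℕ} {p : ℕ → ℕ} (c : (k : Fin s) → Fin (p k)) {k : ℕ} (hk : s ≤ k) :
    cExt s p c k = 0 := dif_neg hk.not_gt

/-- The homology of a coloured complex in terms of complexes with one vertex of each colour. -/
lemma hz_colored_eq_sum (T : Set (ℕ → ℕ)) {s : ℕ} {p b : ℕ → ℕ} {V : Finset ℕ}
    (hp : ∀ k < s, 0 < p k) (hb : ∀ v ∈ V, b v < s) (hV : ∀ k < s, colorCount b V k = p k)
    {r : ℕ → ℕ} (hr : ∀ k < s, r k ∈ V ∧ b (r k) = k) (j : ℤ) :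
    hz K (colored T b V 0) j = ∑ c : (k : Fin s) → Fin (p k),
      ((∏ k ∈ Finset.range s, (p k - 1).choose (cExt s p c k) : ℕ) : ℤ) *
        hz K (colored T b ((Finset.range s).image r) (cExt s p c))
          (j - ∑ k ∈ Finset.range s, (cExt s p c k : ℤ)) := by
  set R := (Finset.range s).image r with hR
  have hRV : R ⊆ V := by
    intro v hv
    obtain ⟨k, hk, rfl⟩ := Finset.mem_image.mp hv
    exact (hr k (Finset.mem_range.mp hk)).1
  have hAb : ∀ v ∈ V \ R, b v < s := fun v hv => hb v (Finset.mem_sdiff.mp hv).1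
  have hcR : ∀ k < s, colorCount b R k = 1 := by
    intro k hk
    rw [colorCount, Finset.card_eq_one]
    refine ⟨r k, ?_⟩
    ext v
    rw [Finset.mem_filter, Finset.mem_singleton]
    constructor
    · rintro ⟨hv, hbv⟩
      obtain ⟨l, hl, rfl⟩ := Finset.mem_image.mp hv
      rw [(hr l (Finset.mem_range.mp hl)).2] at hbv
      rw [hbv]
    · rintro rfl
      exact ⟨Finset.mem_image_of_mem _ (Finset.mem_range.mpr hk), (hr k hk).2⟩
  have hA : ∀ k < s, colorCount b (V \ R) k = p k - 1 := by
    intro k hk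
    rw [← hV k hk, ← hcR k hk, colorCount, colorCount, colorCount,
      ← Finset.card_sdiff_of_subset (Finset.filter_subset_filter _ hRV)]
    congr 1
    ext v
    simp only [Finset.mem_filter, Finset.mem_sdiff]
    tauto
  have hlt : ∀ B ∈ (V \ R).powerset, ∀ k < s, colorCount b B k < p k := by
    intro B hB k hk
    have h1 := colorCount_mono b (Finset.mem_powerset.mp hB) k
    have h2 := hp k hk
    rw [hA k hk] at h1
    omega
  let g : Finset ℕ → (k : Fin s) → Fin (p k) := fun B k =>
    ⟨colorCount b B k % p k, Nat.mod_lt _ (hp k k.2)⟩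
  have hg : ∀ B ∈ (V \ R).powerset, ∀ c, g B = c ↔ ∀ k < s, colorCount b B k = cExt s p c k := by
    intro B hB c
    constructor
    · rintro rfl k hk
      rw [cExt_of_lt _ hk]
      exact (Nat.mod_eq_of_lt (hlt B hB k hk)).symm
    · intro h
      funext k
      apply Fin.ext
      rw [← Fin.eta k k.2, ← cExt_of_lt c k.2, ← h k k.2]
      exact Nat.mod_eq_of_lt (hlt B hB k k.2)
  have hcount : ∀ B ∈ (V \ R).powerset, ∀ c : (k : Fin s) → Fin (p k),
      (∀ k < s, colorCount b B k = cExt s p c k) → colorCount b B = cExt s p c := by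
    intro B hB c h
    funext k
    rcases lt_or_ge k s with hk | hk
    · exact h k hk
    · rw [cExt_of_le c hk, colorCount, Finset.card_eq_zero, Finset.filter_eq_empty_iff]
      intro v hv hvk
      have := hAb v (Finset.mem_powerset.mp hB hv)
      omega
  conv_lhs => rw [← Finset.sdiff_union_of_subset hRV]
  rw [hz_colored_union T Finset.sdiff_disjoint, ← Finset.sum_fiberwise _ g]
  · refine Finset.sum_congr rfl fun c _ => ?_
    have h1 : (V \ R).powerset.filter (fun B => g B = c) =
        (V \ R).powerset.filter (fun B => ∀ k < s, colorCount b B k = cExt s p c k) :=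
      Finset.filter_congr fun B hB => hg B hB c
    have h2 : ∏ k ∈ Finset.range s, (p k - 1).choose (cExt s p c k) =
        ∏ k ∈ Finset.range s, (colorCount b (V \ R) k).choose (cExt s p c k) :=
      Finset.prod_congr rfl fun k hk => by rw [hA k (Finset.mem_range.mp hk)]
    rw [h1, h2, ← card_filter_colorCount hAb, ← nsmul_eq_mul, ← Finset.sum_const]
    refine Finset.sum_congr rfl fun B hB => ?_
    obtain ⟨hB, hBc⟩ := Finset.mem_filter.mp hB
    have h3 := sum_colorCount (F := B) (b := b) (s := s)
      fun v hv => hAb v (Finset.mem_powerset.mp hB hv)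
    rw [← hcount B hB c hBc, zero_add, ← h3]
    push_cast
    rfl
  · intro u hu
    have hk := hAb u hu
    exact ⟨r (b u), Finset.mem_image_of_mem _ (Finset.mem_range.mpr hk), (hr _ hk).2.symm⟩

lemma hz_colored_image_range (T : Set (ℕ → ℕ)) {s : ℕ} {b r : ℕ → ℕ}
    (hr : ∀ k < s, b (r k) = k) (c : ℕ → ℕ) (j : ℤ) :
    hz K (colored T b ((Finset.range s).image r) c) j =
      hz K {F | F ⊆ Finset.range s ∧ c + eF F ∈ T} j := by
  obtain ⟨N, hN⟩ : ∃ N, ∀ k < s, r k < N := by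
    refine ⟨(Finset.range s).sup r + 1, fun k hk => Nat.lt_succ_of_le ?_⟩
    exact Finset.le_sup (f := r) (Finset.mem_range.mpr hk)
  let f : ℕ → ℕ := fun k => if k < s then r k else N + k
  have hfr : ∀ k < s, f k = r k := fun k hk => if_pos hk
  have hf : Function.Injective f := by
    intro k l h
    simp only [f] at h
    split_ifs at h with h1 h2 h2
    · rw [← hr k h1, ← hr l h2, h]
    · have := hN k h1; omega
    · have := hN l h2; omega
    · omega
  have hcount : ∀ F, F ⊆ Finset.range s → colorCount b (F.image f) = eF F := by
    intro F hF
    funext k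
    rw [colorCount, Finset.filter_image, Finset.card_image_of_injective _ hf, eF]
    have : F.filter (fun l => b (f l) = k) = F.filter (fun l => l = k) :=
      Finset.filter_congr fun l hl => by
        have := Finset.mem_range.mp (hF hl)
        rw [hfr l this, hr l this]
    rw [this, Finset.filter_eq']
    split_ifs <;> simp
  rw [← hz_image hf {F | F ⊆ Finset.range s ∧ c + eF F ∈ T}]
  congr 1
  ext G
  constructor
  · rintro ⟨hG, hT⟩
    obtain ⟨F, hF, rfl⟩ := Finset.subset_image_iff.mp hG
    have hF' : F ⊆ Finset.range s := by exact_mod_cast hF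
    have : F.image r = F.image f :=
      Finset.image_congr fun k hk => (hfr k (Finset.mem_range.mp (hF' hk))).symm
    rw [this] at hT ⊢
    rw [hcount F hF'] at hT
    exact ⟨F, ⟨hF', hT⟩, rfl⟩
  · rintro ⟨F, ⟨hF, hT⟩, rfl⟩
    refine ⟨?_, by rwa [hcount F hF]⟩
    have : F.image f = F.image r :=
      Finset.image_congr fun k hk => hfr k (Finset.mem_range.mp (hF hk))
    rw [this]
    exact Finset.image_subset_image hF

end Colored

/-! ## Blocks of a partition -/

section BlockLemmas

lemma cumsum_succ (p : ℕ → ℕ) (k : ℕ) : cumsum p (k + 1) = cumsum p k + p k :=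
  Finset.sum_range_succ _ _

lemma cumsum_mono (p : ℕ → ℕ) : Monotone (cumsum p) :=
  monotone_nat_of_le_succ fun k => by rw [cumsum_succ]; omega

lemma blkOf_eq {p : ℕ → ℕ} {s i k : ℕ} (hk : k ≤ s) (h1 : cumsum p k ≤ i)
    (h2 : k < s → i < cumsum p (k + 1)) : blkOf p s i = k := by
  have : (Finset.range s).filter (fun l => cumsum p (l + 1) ≤ i) = Finset.range k := by
    ext l
    rw [Finset.mem_filter, Finset.mem_range, Finset.mem_range]
    constructor
    · rintro ⟨hl, hli⟩
      by_contra! hkl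
      have := cumsum_mono p (show k + 1 ≤ l + 1 by omega)
      have := h2 (by omega)
      omega
    · intro hl
      have := cumsum_mono p (show l + 1 ≤ k by omega)
      exact ⟨by omega, by omega⟩
  rw [blkOf, this, Finset.card_range]

lemma blkOf_spec (p : ℕ → ℕ) (s i : ℕ) :
    blkOf p s i ≤ s ∧ cumsum p (blkOf p s i) ≤ i ∧
      (blkOf p s i < s → i < cumsum p (blkOf p s i + 1)) := by
  set k := Nat.findGreatest (fun k => cumsum p k ≤ i) s with hk
  have hks : k ≤ s := Nat.findGreatest_le s
  have h1 : cumsum p k ≤ i :=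
    Nat.findGreatest_spec (P := fun k => cumsum p k ≤ i) (Nat.zero_le s) (by simp [cumsum])
  have h2 : k < s → i < cumsum p (k + 1) := fun h => by
    have := Nat.findGreatest_is_greatest (P := fun k => cumsum p k ≤ i) (n := s)
      (show k < k + 1 by omega) h
    simpa using this
  rw [blkOf_eq hks h1 h2]
  exact ⟨hks, h1, h2⟩

lemma blkOf_eq_iff {p : ℕ → ℕ} {s i k : ℕ} (hi : i < cumsum p (s + 1)) (hk : k ≤ s) :
    blkOf p s i = k ↔ cumsum p k ≤ i ∧ i < cumsum p (k + 1) := by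
  constructor
  · rintro rfl
    have h := blkOf_spec p s i
    refine ⟨h.2.1, ?_⟩
    rcases h.1.lt_or_eq with h1 | h1
    · exact h.2.2 h1
    · rwa [h1]
  · rintro ⟨h1, h2⟩
    exact blkOf_eq hk h1 fun _ => h2

lemma card_filter_fin (n : ℕ) (P : ℕ → Prop) [DecidablePred P] :
    (Finset.univ.filter fun i : Fin n => P i).card = ((Finset.range n).filter P).card := by
  rw [← Nat.Iio_eq_range, ← Fin.map_valEmbedding_univ, Finset.filter_map, Finset.card_map]
  rfl

lemma card_filter_blkOf {n s : ℕ} {p : ℕ → ℕ} (hn : n = cumsum p (s + 1)) {k : ℕ} (hk : k ≤ s) :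
    (Finset.univ.filter fun i : Fin n => blkOf p s i = k).card = p k := by
  have h : (Finset.range n).filter (fun i => blkOf p s i = k) =
      Finset.Ico (cumsum p k) (cumsum p (k + 1)) := by
    ext i
    rw [Finset.mem_filter, Finset.mem_range, Finset.mem_Ico, hn]
    constructor
    · rintro ⟨hi, h⟩
      exact (blkOf_eq_iff hi hk).mp h
    · intro h
      have hi : i < cumsum p (s + 1) := h.2.trans_le (cumsum_mono p (by omega))
      exact ⟨hi, (blkOf_eq_iff hi hk).mpr h⟩
  rw [card_filter_fin n fun i => blkOf p s i = k, h, Nat.card_Ico, cumsum_succ]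
  omega

lemma card_filter_last {n s : ℕ} {p c : ℕ → ℕ} (hn : n = cumsum p (s + 1)) {k : ℕ} (hk : k < s)
    (hc : c k ≤ p k) :
    (Finset.univ.filter fun i : Fin n => blkOf p s i = k ∧ blkOf p s i < s ∧
      p (blkOf p s i) - c (blkOf p s i) ≤ i - cumsum p (blkOf p s i)).card = c k := by
  have h : (Finset.range n).filter (fun i => blkOf p s i = k ∧ blkOf p s i < s ∧
      p (blkOf p s i) - c (blkOf p s i) ≤ i - cumsum p (blkOf p s i)) =
      Finset.Ico (cumsum p k + (p k - c k)) (cumsum p (k + 1)) := by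
    ext i
    rw [Finset.mem_filter, Finset.mem_range, Finset.mem_Ico, hn]
    constructor
    · rintro ⟨hi, h, _, h2⟩
      rw [h] at h2
      have := (blkOf_eq_iff hi hk.le).mp h
      omega
    · intro h
      have hi : i < cumsum p (s + 1) := h.2.trans_le (cumsum_mono p (by omega))
      have hb := (blkOf_eq_iff hi hk.le).mpr ⟨by omega, h.2⟩
      rw [hb]
      exact ⟨hi, rfl, hk, by omega⟩
  rw [card_filter_fin n fun i => blkOf p s i = k ∧ blkOf p s i < s ∧
      p (blkOf p s i) - c (blkOf p s i) ≤ i - cumsum p (blkOf p s i), h, Nat.card_Ico, cumsum_succ]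
  omega

lemma exists_perm_of_card_fiber_eq {α β : Type*} [Fintype α] {x y : α → β}
    (h : ∀ c, (Finset.univ.filter fun i => x i = c).card =
      (Finset.univ.filter fun i => y i = c).card) :
    ∃ σ : Equiv.Perm α, ∀ i, y (σ i) = x i := by
  have e : ∀ c, Nonempty ({i // x i = c} ≃ {i // y i = c}) := fun c => by
    rw [← Fintype.card_eq, Fintype.card_subtype, Fintype.card_subtype, h]
  exact ⟨Equiv.ofFiberEquiv fun c => (e c).some, fun i => Equiv.ofFiberEquiv_map _ i⟩

lemma exists_perm_of_card_filter_eq {α β : Type*} [Fintype α] {f g : α → β} {P Q : α → Prop}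
    (h : ∀ k, (Finset.univ.filter fun i => f i = k).card =
      (Finset.univ.filter fun i => g i = k).card)
    (hPQ : ∀ k, (Finset.univ.filter fun i => f i = k ∧ P i).card =
      (Finset.univ.filter fun i => g i = k ∧ Q i).card) :
    ∃ σ : Equiv.Perm α, ∀ i, g (σ i) = f i ∧ (Q (σ i) ↔ P i) := by
  have key : ∀ (f : α → β) (P : α → Prop) k,
      (Finset.univ.filter fun i => f i = k ∧ P i).card +
        (Finset.univ.filter fun i => f i = k ∧ ¬ P i).card =
      (Finset.univ.filter fun i => f i = k).card := fun f P k => by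
    rw [← Finset.filter_filter, ← Finset.filter_filter]
    exact Finset.card_filter_add_card_filter_not _
  obtain ⟨σ, hσ⟩ := exists_perm_of_card_fiber_eq (x := fun i => (f i, P i))
    (y := fun i => (g i, Q i)) (by
      rintro ⟨k, q⟩
      by_cases hq : q
      · simpa [Prod.ext_iff, hq] using hPQ k
      · have h1 := key f P k
        have h2 := key g Q k
        rw [h k, hPQ k] at h1
        simpa [Prod.ext_iff, hq] using (by omega :
          (Finset.univ.filter fun i => f i = k ∧ ¬ P i).card =
            (Finset.univ.filter fun i => g i = k ∧ ¬ Q i).card))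
  refine ⟨σ, fun i => ?_⟩
  have := Prod.ext_iff.mp (hσ i)
  exact ⟨this.1, iff_of_eq this.2⟩

lemma muOf_eq_iff {s : ℕ} {d p : ℕ → ℕ} (hd : ∀ k, k + 1 < s → d (k + 1) < d k)
    (hdpos : ∀ k, k < s → 0 < d k) (i j : ℕ) :
    muOf s d p i = muOf s d p j ↔ blkOf p s i = blkOf p s j := by
  have anti : ∀ k l, k < l → l < s → d l < d k := by
    intro k l hkl
    induction l, hkl using Nat.le_induction with
    | base => exact hd k
    | succ l _ ih => exact fun hl => (hd l hl).trans (ih (by omega))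
  have hi := (blkOf_spec p s i).1
  have hj := (blkOf_spec p s j).1
  refine ⟨fun h => ?_, fun h => by rw [muOf, muOf, h]⟩
  rw [muOf, muOf] at h
  split_ifs at h with h1 h2 h2
  · rcases lt_trichotomy (blkOf p s i) (blkOf p s j) with h3 | h3 | h3
    · have := anti _ _ h3 h2; omega
    · exact h3
    · have := anti _ _ h3 h1; omega
  · have := hdpos _ h1; omega
  · have := hdpos _ h2; omega
  · omega

lemma card_stabilizer_muOf {n s : ℕ} {d p : ℕ → ℕ} (hn : n = cumsum p (s + 1))
    (hd : ∀ k, k + 1 < s → d (k + 1) < d k) (hdpos : ∀ k, k < s → 0 < d k) :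
    (Finset.univ.filter fun σ : Equiv.Perm (Fin n) =>
      (fun t : Fin n => muOf s d p t) ∘ σ = fun t : Fin n => muOf s d p t).card =
      ∏ k ∈ Finset.range (s + 1), (p k).factorial := by
  let f : Fin n → Fin (s + 1) := fun i => ⟨blkOf p s i, Nat.lt_succ_of_le (blkOf_spec p s i).1⟩
  have h1 : ∀ σ : Equiv.Perm (Fin n), ((fun t : Fin n => muOf s d p t) ∘ σ =
      fun t : Fin n => muOf s d p t) ↔ f ∘ σ = f := fun σ => by
    simp only [funext_iff, Function.comp_apply, muOf_eq_iff hd hdpos, f, Fin.ext_iff]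
  simp only [h1]
  rw [← Fintype.card_subtype, DomMulAct.stabilizer_card, Finset.prod_range]
  refine Finset.prod_congr rfl fun k _ => ?_
  rw [Fintype.card_subtype, ← card_filter_blkOf hn (Nat.le_of_lt_succ k.2)]
  simp only [f, Fin.ext_iff]

lemma card_rearrangements_muOf {n s : ℕ} {d p : ℕ → ℕ} (hn : n = cumsum p (s + 1))
    (hd : ∀ k, k + 1 < s → d (k + 1) < d k) (hdpos : ∀ k, k < s → 0 < d k) :
    (Finset.image (fun σ : Equiv.Perm (Fin n) => (fun t : Fin n => muOf s d p t.val) ∘ σ)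
      Finset.univ).card = n.factorial / ∏ k ∈ Finset.range (s + 1), (p k).factorial := by
  set μ : Fin n → ℕ := fun t => muOf s d p t.val with hμ
  symm
  apply Nat.div_eq_of_eq_mul_left (Finset.prod_pos fun k _ => Nat.factorial_pos _)
  have h1 := Finset.card_eq_sum_card_image (fun σ : Equiv.Perm (Fin n) => μ ∘ σ) Finset.univ
  rw [Finset.card_univ, Fintype.card_perm, Fintype.card_fin] at h1
  rw [h1, ← card_stabilizer_muOf hn hd hdpos, ← smul_eq_mul, ← Finset.sum_const]
  refine Finset.sum_congr rfl fun a ha => ?_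
  obtain ⟨τ, -, rfl⟩ := Finset.mem_image.mp ha
  refine Finset.card_equiv (Equiv.mulRight τ⁻¹) fun σ => ?_
  simp only [Finset.mem_filter, Finset.mem_univ, true_and, Equiv.coe_mulRight, Equiv.Perm.coe_mul]
  constructor
  · intro h
    rw [← Function.comp_assoc, h]
    funext i
    simp [hμ]
  · intro h
    funext i
    have := congrFun h (τ i)
    simpa using this

end BlockLemmas

section Ideals

variable {K : Type} [Field K] {n : ℕ} {I : Ideal (MvPolynomial (Fin n) K)}

lemma mon_mem_of_le {x y : Fin n → ℕ} (hxy : ∀ i, x i ≤ y i) (hx : mon K n x ∈ I) :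
    mon K n y ∈ I := by
  have h : mon K n y = mon K n (fun i => y i - x i) * mon K n x := by
    rw [mon, mon, mon, MvPolynomial.monomial_mul, one_mul]
    refine congrArg (fun m => MvPolynomial.monomial m (1 : K)) (Finsupp.ext fun i => ?_)
    exact (Nat.sub_add_cancel (hxy i)).symm
  rw [h]
  exact I.mul_mem_left _ hx

lemma mon_comp_perm_mem (hsym : IsSymmetricIdeal K n I) (σ : Equiv.Perm (Fin n))
    {x : Fin n → ℕ} (hx : mon K n x ∈ I) : mon K n (x ∘ σ) ∈ I := by
  have h : MvPolynomial.rename σ.symm (mon K n x) = mon K n (x ∘ σ) := by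
    rw [mon, mon, MvPolynomial.rename_monomial]
    refine congrArg (fun m => MvPolynomial.monomial m (1 : K)) (Finsupp.ext fun i => ?_)
    obtain ⟨j, rfl⟩ := σ.symm.surjective i
    rw [Finsupp.mapDomain_apply σ.symm.injective]
    simp
  rw [← h, ← hsym σ.symm]
  exact Ideal.mem_map_of_mem (MvPolynomial.rename σ.symm).toRingHom hx

lemma mon_comp_perm_mem_iff (hsym : IsSymmetricIdeal K n I) (σ : Equiv.Perm (Fin n))
    (x : Fin n → ℕ) : mon K n (x ∘ σ) ∈ I ↔ mon K n x ∈ I := by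
  refine ⟨fun h => ?_, mon_comp_perm_mem hsym σ⟩
  have := mon_comp_perm_mem hsym σ.symm h
  rwa [Function.comp_assoc, Equiv.self_comp_symm, Function.comp_id] at this

lemma muMinus_anti (s : ℕ) (d p : ℕ → ℕ) {c c' : ℕ → ℕ} (h : ∀ k, c k ≤ c' k) (i : ℕ) :
    muMinus s d p c' i ≤ muMinus s d p c i := by
  have := h (blkOf p s i)
  rw [muMinus, muMinus]
  split_ifs <;> omega

lemma eF_erase_le (F : Finset ℕ) (v j : ℕ) : eF (F.erase v) j ≤ eF F j := by
  rw [eF, eF]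
  split_ifs with h1 h2
  · exact le_rfl
  · exact absurd (Finset.mem_of_mem_erase h1) h2
  all_goals simp

lemma erase_mem_DeltaCx (s : ℕ) (d p c : ℕ → ℕ) :
    ∀ F ∈ DeltaCx K n I s d p c, ∀ v, F.erase v ∈ DeltaCx K n I s d p c := fun F hF v =>
  ⟨(Finset.erase_subset _ _).trans hF.1, mon_mem_of_le (fun i => muMinus_anti s d p
    (fun k => Nat.add_le_add_left (eF_erase_le F v k) _) i) hF.2⟩

lemma erase_mem_KosI (a : Fin n → ℕ) :
    ∀ F ∈ KosI K n I a, ∀ v, F.erase v ∈ KosI K n I a := fun F hF v =>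
  ⟨(Finset.erase_subset _ _).trans hF.1, fun i hi => hF.2.1 i (Finset.mem_of_mem_erase hi),
    mon_mem_of_le (fun i => Nat.sub_le_sub_left (eF_erase_le F v i) _) hF.2.2⟩

lemma finite_of_subset_range {Δ : Set (Finset ℕ)} {m : ℕ} (h : ∀ F ∈ Δ, F ⊆ Finset.range m) :
    Δ.Finite :=
  (Finset.finite_toSet (Finset.range m).powerset).subset fun F hF =>
    Finset.mem_coe.mpr (Finset.mem_powerset.mpr (h F hF))

/-- The block containing the image of a position under `σ`. -/
def blkColor {n : ℕ} (p : ℕ → ℕ) (s : ℕ) (σ : Equiv.Perm (Fin n)) (v : ℕ) : ℕ :=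
  if h : v < n then blkOf p s (σ ⟨v, h⟩) else s

lemma blkColor_val {n : ℕ} (p : ℕ → ℕ) (s : ℕ) (σ : Equiv.Perm (Fin n)) (i : Fin n) :
    blkColor p s σ i = blkOf p s (σ i) := dif_pos i.2

lemma colorCount_blkColor {s : ℕ} {p : ℕ → ℕ} {σ : Equiv.Perm (Fin n)} {F : Finset ℕ}
    (hF : F ⊆ Finset.range n) (k : ℕ) :
    (Finset.univ.filter fun i : Fin n => blkOf p s (σ i) = k ∧ (i : ℕ) ∈ F).card =
      colorCount (blkColor p s σ) F k := by
  simp only [← blkColor_val]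
  rw [card_filter_fin n fun v => blkColor p s σ v = k ∧ v ∈ F, colorCount]
  congr 1
  ext v
  simp only [Finset.mem_filter]
  exact ⟨fun h => ⟨h.2.2, h.2.1⟩, fun h => ⟨hF h.1, h.2, h.1⟩⟩

lemma card_filter_blkOf_perm {s : ℕ} (p : ℕ → ℕ) (σ : Equiv.Perm (Fin n)) (k : ℕ) :
    (Finset.univ.filter fun i : Fin n => blkOf p s (σ i) = k).card =
      (Finset.univ.filter fun i : Fin n => blkOf p s i = k).card :=
  Finset.card_equiv σ fun i => by simp

lemma colorCount_le {s : ℕ} {p : ℕ → ℕ} (hn : n = cumsum p (s + 1)) {σ : Equiv.Perm (Fin n)}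
    {F : Finset ℕ} (hF : F ⊆ Finset.range n) {k : ℕ} (hk : k ≤ s) :
    colorCount (blkColor p s σ) F k ≤ p k := by
  rw [← card_filter_blkOf hn hk, ← card_filter_blkOf_perm p σ, ← colorCount_blkColor hF]
  exact Finset.card_le_card fun i hi => by
    rw [Finset.mem_filter] at hi ⊢
    exact ⟨hi.1, hi.2.1⟩

lemma mon_sub_eF_mem_iff (hsym : IsSymmetricIdeal K n I) {s : ℕ} {d p : ℕ → ℕ}
    (hn : n = cumsum p (s + 1)) (σ : Equiv.Perm (Fin n)) {F : Finset ℕ} (hF : F ⊆ Finset.range n)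
    (hFs : ∀ v ∈ F, blkColor p s σ v < s) :
    mon K n (fun i => muOf s d p (σ i) - eF F i) ∈ I ↔
      mon K n (fun i => muMinus s d p (colorCount (blkColor p s σ) F) i) ∈ I := by
  set c := colorCount (blkColor p s σ) F with hc
  obtain ⟨τ, hτ⟩ := exists_perm_of_card_filter_eq (f := fun i : Fin n => blkOf p s (σ i))
    (g := fun i : Fin n => blkOf p s i) (P := fun i => (i : ℕ) ∈ F)
    (Q := fun i => blkOf p s i < s ∧
      p (blkOf p s i) - c (blkOf p s i) ≤ i - cumsum p (blkOf p s i))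
    (fun k => by convert card_filter_blkOf_perm p σ k)
    (fun k => by
      rcases lt_or_ge k s with hk | hk
      · have h1 := colorCount_blkColor (s := s) (p := p) (σ := σ) hF k
        have h2 := card_filter_last hn hk (colorCount_le hn (σ := σ) hF hk.le)
        convert h1.trans h2.symm
      · have h1 : (Finset.univ.filter fun i : Fin n =>
            blkOf p s (σ i) = k ∧ (i : ℕ) ∈ F).card = 0 :=
          Finset.card_eq_zero.mpr (Finset.filter_eq_empty_iff.mpr fun i _ h => by
            have := hFs i h.2
            rw [blkColor_val] at this
            omega)
        have h2 : (Finset.univ.filter fun i : Fin n => blkOf p s i = k ∧ blkOf p s i < s ∧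
            p (blkOf p s i) - c (blkOf p s i) ≤ i - cumsum p (blkOf p s i)).card = 0 :=
          Finset.card_eq_zero.mpr (Finset.filter_eq_empty_iff.mpr fun i _ h => by omega)
        convert h1.trans h2.symm)
  rw [← mon_comp_perm_mem_iff hsym τ fun i => muMinus s d p c i]
  apply iff_of_eq
  congr 2
  funext i
  obtain ⟨h1, h2⟩ := hτ i
  rw [Function.comp_apply, muOf, muMinus, eF, ← h1]
  by_cases hb : blkOf p s (τ i) < s
  · by_cases hi : (i : ℕ) ∈ F
    · rw [if_pos hb, if_pos hi, if_pos hb, if_pos (h2.mpr hi).2]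
    · rw [if_pos hb, if_neg hi, if_pos hb, if_neg (fun h => hi (h2.mp ⟨hb, h⟩)), Nat.sub_zero]
  · rw [if_neg hb, if_neg hb, Nat.zero_sub]

lemma KosI_eq_colored (hsym : IsSymmetricIdeal K n I) {s : ℕ} {d p : ℕ → ℕ}
    (hn : n = cumsum p (s + 1)) (hdpos : ∀ k, k < s → 0 < d k) (σ : Equiv.Perm (Fin n)) :
    KosI K n I ((fun t : Fin n => muOf s d p t) ∘ σ) =
      colored {c | mon K n (fun i => muMinus s d p c i) ∈ I} (blkColor p s σ)
        ((Finset.range n).filter fun v => blkColor p s σ v < s) 0 := by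
  have hpos : ∀ i : Fin n, 1 ≤ muOf s d p (σ i) ↔ blkColor p s σ i < s := fun i => by
    rw [blkColor_val, muOf]
    split_ifs with h
    · exact iff_of_true (hdpos _ h) h
    · exact iff_of_false (by omega) h
  ext F
  constructor
  · rintro ⟨hF, h1, h2⟩
    have hFs : ∀ v ∈ F, blkColor p s σ v < s := fun v hv =>
      (hpos ⟨v, Finset.mem_range.mp (hF hv)⟩).mp (h1 ⟨v, Finset.mem_range.mp (hF hv)⟩ hv)
    refine ⟨fun v hv => Finset.mem_filter.mpr ⟨hF hv, hFs v hv⟩, ?_⟩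
    rw [zero_add]
    exact (mon_sub_eF_mem_iff hsym hn σ hF hFs).mp h2
  · rintro ⟨hF, h2⟩
    have hFn : F ⊆ Finset.range n := hF.trans (Finset.filter_subset _ _)
    have hFs : ∀ v ∈ F, blkColor p s σ v < s := fun v hv => (Finset.mem_filter.mp (hF hv)).2
    rw [zero_add] at h2
    exact ⟨hFn, fun i hi => (hpos i).mpr (hFs i hi),
      (mon_sub_eF_mem_iff hsym hn σ hFn hFs).mpr h2⟩

lemma torDim_muOf_comp (hsym : IsSymmetricIdeal K n I) {s : ℕ} {d p : ℕ → ℕ}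
    (hn : n = cumsum p (s + 1)) (hdpos : ∀ k, k < s → 0 < d k) (hppos : ∀ k, k < s → 0 < p k)
    (σ : Equiv.Perm (Fin n)) (i : ℕ) :
    torDim K n I i ((fun t : Fin n => muOf s d p t) ∘ σ) =
      ∑ c : (k : Fin s) → Fin (p k),
        (∏ k ∈ Finset.range s, Nat.choose (p k - 1) (cExt s p c k)) *
          hdim0 K (DeltaCx K n I s d p (cExt s p c))
            ((i : ℤ) - (∑ k ∈ Finset.range s, (cExt s p c k : ℤ)) - 1) := by
  set V := (Finset.range n).filter fun v => blkColor p s σ v < s with hVdef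
  have hVcount : ∀ k < s, colorCount (blkColor p s σ) V k = p k := fun k hk => by
    rw [← card_filter_blkOf hn hk.le, ← card_filter_blkOf_perm p σ,
      ← colorCount_blkColor (Finset.filter_subset _ _)]
    congr 1
    refine Finset.filter_congr fun i _ => and_iff_left_of_imp fun h => ?_
    exact Finset.mem_filter.mpr ⟨Finset.mem_range.mpr i.2, by rw [blkColor_val]; omega⟩
  have hrep : ∀ k, ∃ v, k < s → v ∈ V ∧ blkColor p s σ v = k := fun k => by
    by_cases hk : k < s
    · have h := hppos k hk
      rw [← hVcount k hk, colorCount, Finset.card_pos] at h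
      obtain ⟨v, hv⟩ := h
      exact ⟨v, fun _ => Finset.mem_filter.mp hv⟩
    · exact ⟨0, fun h => absurd h hk⟩
  choose r hr using hrep
  have hfinK := finite_of_subset_range (Δ := KosI K n I ((fun t : Fin n => muOf s d p t) ∘ σ))
    fun F hF => hF.1
  have h1 := rhd_eq_hz (K := K) hfinK (erase_mem_KosI _) i
  rw [KosI_eq_colored hsym hn hdpos σ, hz_colored_eq_sum _ hppos
    (fun v hv => (Finset.mem_filter.mp hv).2) hVcount hr] at h1
  rw [torDim, rhd0, KosI_eq_colored hsym hn hdpos σ]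
  apply Nat.cast_injective (R := ℤ)
  rw [Nat.cast_sum]
  refine h1.trans (Finset.sum_congr rfl fun c _ => ?_)
  rw [hz_colored_image_range _ (fun k hk => (hr k hk).2), Nat.cast_mul, hdim0_eq_hz
    (finite_of_subset_range fun F hF => hF.1) (erase_mem_DeltaCx s d p _)]
  rfl

end Ideals

/-- equivariant Hochster formula, dimension form.  For an
`S_n`-invariant monomial ideal `I` and `μ = (d_1^{p_1}, …, d_s^{p_s}, 0^{p_{s+1}}) ∈ P_n`
with `d_1 > ⋯ > d_s > 0`, for every `i ≥ 0`:
`dim_k Tor_i(I,k)_{⟨μ⟩} = Σ_{0 ≤ c ≤ p(μ)} D(c) · γ_{i-|c|}^{μ,c}(I)`, where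
`D(c) = (n!/(p_1! ⋯ p_s! p_{s+1}!)) · Π_k C(p_k - 1, c_k)` is the dimension of the
corresponding induced representation of tensor products of hook Specht modules, and
`γ_j^{μ,c}(I) = dim_k H̃_{j-1}(Δ^{μ,c}(I))` (zero for `j < 0`). -/
theorem statement_0 (K : Type) [Field K] (n s : ℕ) (d p : ℕ → ℕ)
    (hn : n = cumsum p (s + 1))
    (hd : ∀ k, k + 1 < s → d (k + 1) < d k)
    (hdpos : ∀ k, k < s → 0 < d k)
    (hppos : ∀ k, k < s → 0 < p k)
    (I : Ideal (MvPolynomial (Fin n) K))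
    (hmon : IsMonomialIdeal K n I) (hsym : IsSymmetricIdeal K n I)
    (i : ℕ) :
    torDimSym K n I i (fun t => muOf s d p t.val) =
      ∑ c : (k : Fin s) → Fin (p k),
        ((n.factorial / ∏ k ∈ Finset.range (s + 1), (p k).factorial) *
            ∏ k ∈ Finset.range s, Nat.choose (p k - 1) (cExt s p c k)) *
          hdim0 K (DeltaCx K n I s d p (cExt s p c))
            ((i : ℤ) - (∑ k ∈ Finset.range s, (cExt s p c k : ℤ)) - 1) := by
  have h : ∀ a ∈ Finset.image (fun σ : Equiv.Perm (Fin n) =>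
      (fun t : Fin n => muOf s d p t.val) ∘ σ) Finset.univ, torDim K n I i a =
      ∑ c : (k : Fin s) → Fin (p k),
        (∏ k ∈ Finset.range s, Nat.choose (p k - 1) (cExt s p c k)) *
          hdim0 K (DeltaCx K n I s d p (cExt s p c))
            ((i : ℤ) - (∑ k ∈ Finset.range s, (cExt s p c k : ℤ)) - 1) := fun a ha => by
    obtain ⟨σ, -, rfl⟩ := Finset.mem_image.mp ha
    exact torDim_muOf_comp hsym hn hdpos hppos σ i
  rw [torDimSym, Finset.sum_congr rfl h, Finset.sum_const, smul_eq_mul,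
    card_rearrangements_muOf hn hd hdpos, Finset.mul_sum]
  exact Finset.sum_congr rfl fun c _ => (mul_assoc _ _ _).symm
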